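/- arXiv:1705.00924 — 4 statements merged into one kernel-verified Lean document; each statement's English description precedes it below -/
import Mathlib

section
/- Let T ⊆ ℝ² be a closed non-acute triangle whose incircle has area a; let its apex be the vertex of its largest angle, let α and β be the two base angles (the angles at the two other vertices), and let (f₁, f₂) be the associated split key of T. Then for all (a, 0, (f₁,f₂))-conjugated tuples (a₁, b₁), (a₂, b₂) with b₁ ≤ a₁ and b₂ ≤ a₂, a right (a₁, b₁)-hat having an acute angle equal to α and a right (a₂, b₂)-hat having an acute angle equal to β can be packed into T: there exist isometries g₁, g₂ of ℝ² mapping these hats to subsets of T whose interiors are disjoint. -/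
noncomputable section

abbrev Plane := EuclideanSpace ℝ (Fin 2)

def pt (x y : ℝ) : Plane := (WithLp.equiv 2 (Fin 2 → ℝ)).symm ![x, y]

/-- The union of all closed disks of radius `s` contained in `T`
(`T` with its corners rounded to radius `s`). -/
def roundCorners (s : ℝ) (T : Set Plane) : Set Plane :=
  ⋃ c ∈ {c : Plane | Metric.closedBall c s ⊆ T}, Metric.closedBall c s

/-- Inradius of a right triangle with legs `p` and `q`. -/
def rho (p q : ℝ) : ℝ := (p + q - Real.sqrt (p ^ 2 + q ^ 2)) / 2

/-- A closed right triangle with an acute angle `α` and incircle area `a`: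
right angle at the origin, horizontal leg `ℓ`, vertical leg `ℓ·tan α`, where `ℓ` is
scaled so that the incircle area is `a`; the angle at the vertex `(ℓ,0)` equals `α`. -/
def rightTriangleAngle (α a : ℝ) : Set Plane :=
  convexHull ℝ {pt 0 0, pt (Real.sqrt (a / Real.pi) / rho 1 (Real.tan α)) 0,
    pt 0 (Real.sqrt (a / Real.pi) / rho 1 (Real.tan α) * Real.tan α)}

/-- The right `(a,b)`-hat with an acute angle `α`. -/
def rightHatAngle (α a b : ℝ) : Set Plane :=
  roundCorners (Real.sqrt (b / Real.pi)) (rightTriangleAngle α a)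

/-- Tuples `(a₁,b₁)`, `(a₂,b₂)` are `(a, b, (f₁,f₂))`-conjugated. -/
def Conjugated (a b f₁ f₂ a₁ b₁ a₂ b₂ : ℝ) : Prop :=
  a₁ + a₂ = a ∧ b ≤ b₁ ∧ b ≤ b₂ ∧ a₁ - f₁ * a₂ / f₂ ≤ b₁ ∧ a₂ - f₂ * a₁ / f₁ ≤ b₂

@[simp] theorem pt_apply_zero (x y : ℝ) : pt x y 0 = x := rfl

@[simp] theorem pt_apply_one (x y : ℝ) : pt x y 1 = y := rfl

theorem pt_eta (p : Plane) : pt (p 0) (p 1) = p := by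
  ext i
  fin_cases i <;> rfl

theorem dist_sq_plane (p q : Plane) : dist p q ^ 2 = (p 0 - q 0) ^ 2 + (p 1 - q 1) ^ 2 := by
  rw [EuclideanSpace.dist_eq, Real.sq_sqrt (by positivity), Fin.sum_univ_two, Real.dist_eq,
    Real.dist_eq, sq_abs, sq_abs]

/-- Translation by `m` along the first axis. -/
def horizontalShift (m : ℝ) : Plane ≃ᵢ Plane :=
  IsometryEquiv.mk' (fun p => pt (m + p 0) (p 1)) (fun p => pt (p 0 - m) (p 1))
    (fun p => by
      rw [← pt_eta p]
      simp)
    (Isometry.of_dist_eq fun p q => by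
      rw [← sq_eq_sq₀ dist_nonneg dist_nonneg, dist_sq_plane, dist_sq_plane]
      simp)

/-- The reflection swapping the abscissae `0` and `m`. -/
def horizontalReflection (m : ℝ) : Plane ≃ᵢ Plane :=
  IsometryEquiv.mk' (fun p => pt (m - p 0) (p 1)) (fun p => pt (m - p 0) (p 1))
    (fun p => by
      rw [← pt_eta p]
      simp)
    (Isometry.of_dist_eq fun p q => by
      rw [← sq_eq_sq₀ dist_nonneg dist_nonneg, dist_sq_plane, dist_sq_plane]
      simp only [pt_apply_zero, pt_apply_one]
      ring)

theorem horizontalShift_apply (m : ℝ) (p : Plane) :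
    horizontalShift m p = pt (m + p 0) (p 1) := rfl

theorem horizontalReflection_apply (m : ℝ) (p : Plane) :
    horizontalReflection m p = pt (m - p 0) (p 1) := rfl

theorem disjoint_interior_of_separated {A B : Set Plane} {m : ℝ}
    (hA : ∀ p ∈ A, p 0 ≤ m) (hB : ∀ p ∈ B, m ≤ p 0) :
    Disjoint (interior A) (interior B) := by
  have hopen : IsOpenMap (EuclideanSpace.proj (𝕜 := ℝ) (0 : Fin 2) : Plane → ℝ) :=
    ContinuousLinearMap.isOpenMap _ fun y => ⟨pt y 0, rfl⟩
  have hcont : Continuous (EuclideanSpace.proj (𝕜 := ℝ) (0 : Fin 2) : Plane → ℝ) :=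
    ContinuousLinearMap.continuous _
  rw [Set.disjoint_left]
  intro p hpA hpB
  have h₁ : p ∈ interior ((EuclideanSpace.proj (𝕜 := ℝ) (0 : Fin 2) : Plane → ℝ) ⁻¹' Set.Iic m) :=
    interior_mono (fun q hq => hA q hq) hpA
  have h₂ : p ∈ interior ((EuclideanSpace.proj (𝕜 := ℝ) (0 : Fin 2) : Plane → ℝ) ⁻¹' Set.Ici m) :=
    interior_mono (fun q hq => hB q hq) hpB
  rw [← hopen.preimage_interior_eq_interior_preimage hcont] at h₁ h₂
  rw [interior_Iic] at h₁
  rw [interior_Ici] at h₂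
  have h₁' : p 0 < m := h₁
  have h₂' : m < p 0 := h₂
  exact lt_asymm h₁' h₂'

theorem mem_triangle_of_halfPlanes {h w₁ w₂ : ℝ} (hh : 0 < h) (hw₁ : 0 < w₁) (hw₂ : 0 < w₂)
    {p : Plane} (h₀ : 0 ≤ p 1) (h₁ : -(h * p 0) + w₁ * p 1 ≤ h * w₁)
    (h₂ : h * p 0 + w₂ * p 1 ≤ h * w₂) :
    p ∈ convexHull ℝ ({pt 0 h, pt (-w₁) 0, pt w₂ 0} : Set Plane) := by
  have hw : 0 < w₁ + w₂ := add_pos hw₁ hw₂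
  have hcombo : p = (p 1 / h) • pt 0 h +
      (((h * w₂ - h * p 0 - w₂ * p 1) / (h * (w₁ + w₂))) • pt (-w₁) 0 +
        ((h * w₁ + h * p 0 - w₁ * p 1) / (h * (w₁ + w₂))) • pt w₂ 0) := by
    ext i
    fin_cases i
    · simp
      field_simp
      ring
    · simp
      field_simp
  rw [hcombo]
  have hmem {q : Plane} (hq : q ∈ ({pt 0 h, pt (-w₁) 0, pt w₂ 0} : Set Plane)) :=
    subset_convexHull ℝ _ hq
  have hconv := (convex_convexHull ℝ
    ({pt 0 h, pt (-w₁) 0, pt w₂ 0} : Set Plane)).sum_mem (t := Finset.univ)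
    (w := ![p 1 / h, (h * w₂ - h * p 0 - w₂ * p 1) / (h * (w₁ + w₂)),
      (h * w₁ + h * p 0 - w₁ * p 1) / (h * (w₁ + w₂))])
    (z := ![pt 0 h, pt (-w₁) 0, pt w₂ 0]) ?_ ?_ ?_
  · simpa [Fin.sum_univ_three, add_assoc] using hconv
  · intro i _
    fin_cases i
    · exact div_nonneg h₀ hh.le
    · exact div_nonneg (by linarith) (by positivity)
    · exact div_nonneg (by linarith) (by positivity)
  · simp only [Fin.sum_univ_three, Matrix.cons_val]
    field_simp
    ring
  · intro i _
    apply hmem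
    fin_cases i <;> simp

theorem halfPlanes_of_mem_rightTriangle {h w ℓ : ℝ} (hh : 0 < h) (hw : 0 < w) (hℓ : 0 ≤ ℓ)
    {p : Plane} (hp : p ∈ convexHull ℝ ({pt 0 0, pt ℓ 0, pt 0 (ℓ * (h / w))} : Set Plane)) :
    0 ≤ p 0 ∧ 0 ≤ p 1 ∧ h * p 0 + w * p 1 ≤ h * ℓ := by
  have hconv : Convex ℝ {p : Plane | 0 ≤ p 0 ∧ 0 ≤ p 1 ∧ h * p 0 + w * p 1 ≤ h * ℓ} := by
    rintro x ⟨hx₀, hx₁, hx₂⟩ y ⟨hy₀, hy₁, hy₂⟩ a b ha hb hab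
    refine ⟨?_, ?_, ?_⟩
    · simp only [PiLp.add_apply, PiLp.smul_apply, smul_eq_mul]
      positivity
    · simp only [PiLp.add_apply, PiLp.smul_apply, smul_eq_mul]
      positivity
    · simp only [PiLp.add_apply, PiLp.smul_apply, smul_eq_mul]
      have hb' : b = 1 - a := by linarith
      subst hb'
      nlinarith [mul_le_mul_of_nonneg_left hx₂ ha, mul_le_mul_of_nonneg_left hy₂ hb]
  refine convexHull_min ?_ hconv hp
  rintro q (rfl | rfl | rfl)
  · refine ⟨?_, ?_, ?_⟩ <;> simp; positivity
  · refine ⟨?_, ?_, ?_⟩ <;> simp [hℓ]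
  · refine ⟨?_, ?_, ?_⟩ <;> simp
    · positivity
    · apply le_of_eq
      field_simp

/-- A disk of radius `s` in the right triangle with base angle `arctan (h / w₂)` and leg `ℓ` stays,
after the triangle is put into the corner `(w₂, 0)`, on the correct side of the line through
`(-w₁, 0)` and `(0, h)`. -/
theorem placed_roundCorners_halfPlanes {h w₁ w₂ H₁ H₂ ℓ s : ℝ} (hh : 0 < h) (hw₁ : 0 < w₁)
    (hw₂ : 0 < w₂) (hH₁ : 0 < H₁) (hH₂ : 0 < H₂) (hH₁sq : H₁ ^ 2 = h ^ 2 + w₁ ^ 2)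
    (hH₂sq : H₂ ^ 2 = h ^ 2 + w₂ ^ 2) (hℓ : 0 ≤ ℓ) (hs : 0 ≤ s)
    (hfit : (ℓ - w₂) * (h * (w₁ + w₂)) ≤ s * (h * (w₁ + w₂) + w₁ * H₂ - w₂ * H₁))
    {p : Plane} (hp : p ∈ roundCorners s
      (convexHull ℝ ({pt 0 0, pt ℓ 0, pt 0 (ℓ * (h / w₂))} : Set Plane))) :
    0 ≤ p 0 ∧ 0 ≤ p 1 ∧ h * (w₂ - ℓ + p 0) + w₂ * p 1 ≤ h * w₂ ∧
      -(h * (w₂ - ℓ + p 0)) + w₁ * p 1 ≤ h * w₁ := by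
  simp only [roundCorners, Set.mem_iUnion, Set.mem_ofPred_eq, exists_prop] at hp
  obtain ⟨c, hc, hpc⟩ := hp
  obtain ⟨hp₀, hp₁, hp₂⟩ := halfPlanes_of_mem_rightTriangle hh hw₂ hℓ (hc hpc)
  refine ⟨hp₀, hp₁, by linarith, ?_⟩
  have mem_ball {q : Plane} (hq : (q 0 - c 0) ^ 2 + (q 1 - c 1) ^ 2 ≤ s ^ 2) :
      q ∈ Metric.closedBall c s := by
    rw [Metric.mem_closedBall, ← sq_le_sq₀ dist_nonneg hs, dist_sq_plane]
    exact hq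
  have hleft := (halfPlanes_of_mem_rightTriangle hh hw₂ hℓ
    (hc (mem_ball (q := pt (c 0 - s) (c 1)) (by simp)))).1
  have htop := (halfPlanes_of_mem_rightTriangle hh hw₂ hℓ
    (hc (mem_ball (q := pt (c 0 + s * (h / H₂)) (c 1 + s * (w₂ / H₂))) (by
      apply le_of_eq
      simp only [pt_apply_zero, pt_apply_one]
      field_simp
      linear_combination (-s ^ 2) * hH₂sq)))).2.2
  simp only [pt_apply_zero, pt_apply_one] at hleft htop
  have hc₀ : s ≤ c 0 := by linarith
  have hc₁ : h * c 0 + w₂ * c 1 + s * H₂ ≤ h * ℓ := by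
    have : h * (s * (h / H₂)) + w₂ * (s * (w₂ / H₂)) = s * H₂ := by
      field_simp
      linear_combination (-s) * hH₂sq
    linarith
  have hv : -(h * (p 0 - c 0)) + w₁ * (p 1 - c 1) ≤ s * H₁ := by
    rw [Metric.mem_closedBall, ← sq_le_sq₀ dist_nonneg hs, dist_sq_plane] at hpc
    refine (abs_le_of_sq_le_sq' ?_ (by positivity)).2
    rw [mul_pow, hH₁sq]
    nlinarith [mul_le_mul_of_nonneg_right hpc (by positivity : 0 ≤ h ^ 2 + w₁ ^ 2),
      sq_nonneg (w₁ * (p 0 - c 0) + h * (p 1 - c 1))]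
  have hkey : w₂ * (-(h * (w₂ - ℓ + c 0)) + w₁ * c 1 + s * H₁) ≤ w₂ * (h * w₁) := by
    nlinarith [mul_le_mul_of_nonneg_left hc₁ hw₁.le,
      mul_le_mul_of_nonneg_left hc₀ (by positivity : 0 ≤ h * (w₁ + w₂))]
  have := le_of_mul_le_mul_left hkey hw₂
  linarith

/-- Parametrization of a right triangle by the tangent `t` of half an acute angle. -/
theorem exists_halfAngle {h w : ℝ} (hh : 0 < h) (hw : 0 < w) :
    ∃ t : ℝ, 0 < t ∧ t < 1 ∧ w = h * (1 - t ^ 2) / (2 * t) ∧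
      Real.sqrt (h ^ 2 + w ^ 2) = h * (1 + t ^ 2) / (2 * t) ∧
      rho h w = h / 2 * (1 - t) ∧ rho 1 (h / w) = t / (1 + t) := by
  obtain ⟨H, hH⟩ : ∃ H, H = Real.sqrt (h ^ 2 + w ^ 2) := ⟨_, rfl⟩
  have hHsq : H ^ 2 = h ^ 2 + w ^ 2 := by rw [hH, Real.sq_sqrt (by positivity)]
  have hHpos : 0 < H := by rw [hH]; positivity
  have hHw : w < H := by nlinarith
  have hHhw : H < w + h := by nlinarith
  have hdiv : Real.sqrt (1 ^ 2 + (h / w) ^ 2) = H / w := by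
    rw [Real.sqrt_eq_iff_mul_self_eq (by positivity) (by positivity)]
    field_simp
    linarith
  refine ⟨(H - w) / h, div_pos (by linarith) hh, (div_lt_one hh).2 (by linarith), ?_, ?_, ?_, ?_⟩
  · have : H - w ≠ 0 := by linarith
    field_simp
    linear_combination hHsq
  · rw [← hH]
    have : H - w ≠ 0 := by linarith
    field_simp
    linear_combination hHsq
  · rw [rho, ← hH]
    field_simp
    ring
  · rw [rho, hdiv]
    have : h + (H - w) ≠ 0 := by linarith
    field_simp
    linear_combination (-1) * hHsq

theorem legs_add_le {k t₁ t₂ u₁ u₂ : ℝ} (hk : 0 < k) (ht₁ : 0 < t₁) (ht₂ : 0 < t₂)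
    (hle : t₁ + t₂ + t₁ * t₂ ≤ 1) (hu : u₁ ^ 2 + u₂ ^ 2 = (k * (1 - t₁ * t₂)) ^ 2) :
    u₁ * (1 + t₁) / t₁ + u₂ * (1 + t₂) / t₂ ≤
      k * (1 - t₁ ^ 2) / t₁ + k * (1 - t₂ ^ 2) / t₂ := by
  have hprod : 0 < t₁ * t₂ := mul_pos ht₁ ht₂
  have hr : 0 ≤ k * (1 - t₁ * t₂) := mul_nonneg hk.le (by linarith)
  have hmain : u₁ * ((1 + t₁) * t₂) + u₂ * ((1 + t₂) * t₁) ≤ k * (1 - t₁ * t₂) * (t₁ + t₂) := by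
    refine (abs_le_of_sq_le_sq' ?_ (mul_nonneg hr (by positivity))).2
    rw [mul_pow, ← hu]
    have hcoef : ((1 + t₁) * t₂) ^ 2 + ((1 + t₂) * t₁) ^ 2 ≤ (t₁ + t₂) ^ 2 := by
      nlinarith [mul_le_mul_of_nonneg_left hle hprod.le]
    nlinarith [mul_le_mul_of_nonneg_left hcoef (by positivity : 0 ≤ u₁ ^ 2 + u₂ ^ 2),
      sq_nonneg (u₁ * ((1 + t₂) * t₁) - u₂ * ((1 + t₁) * t₂))]
  rw [div_add_div _ _ ht₁.ne' ht₂.ne', div_add_div _ _ ht₁.ne' ht₂.ne']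
  refine div_le_div_of_nonneg_right ?_ hprod.le
  linarith

theorem rounding_suffices {k t₁ t₂ u₁ u₂ s : ℝ} (hk : 0 < k) (ht₁ : 0 < t₁) (ht₂ : 0 < t₂)
    (ht₁' : t₁ < 1) (ht₂' : t₂ < 1)
    (hle : t₁ + t₂ + t₁ * t₂ ≤ 1) (hu : u₁ ^ 2 + u₂ ^ 2 = (k * (1 - t₁ * t₂)) ^ 2)
    (hs : 0 ≤ s)
    (hround : u₂ ^ 2 * (1 - t₁) ^ 2 - u₁ ^ 2 * (1 - t₂) ^ 2 ≤ s ^ 2 * (1 - t₁) ^ 2) :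
    (u₂ - k * (1 - t₂)) * (1 - t₁ * t₂) ≤ s * (1 - t₁) * t₂ := by
  have hR : 0 < 1 - t₁ * t₂ := by nlinarith
  have hrhs : 0 ≤ s * (1 - t₁) * t₂ :=
    mul_nonneg (mul_nonneg hs (by linarith)) ht₂.le
  rcases le_total u₂ (k * (1 - t₂)) with hsmall | hlarge
  · exact (mul_nonpos_of_nonpos_of_nonneg (by linarith) hR.le).trans hrhs
  have hur : u₂ ≤ k * (1 - t₁ * t₂) :=
    (abs_le_of_sq_le_sq' (by nlinarith [sq_nonneg u₁]) (by positivity)).2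
  refine (abs_le_of_sq_le_sq' ?_ hrhs).2
  obtain ⟨A, hA⟩ : ∃ A, A = (1 - t₁ * t₂) ^ 2 - t₂ ^ 2 * ((1 - t₁) ^ 2 + (1 - t₂) ^ 2) := ⟨_, rfl⟩
  have hAB : (1 - t₁ * t₂) * (1 - t₂) * (1 + t₂ ^ 2) ≤ A := by
    have : A - (1 - t₁ * t₂) * (1 - t₂) * (1 + t₂ ^ 2) =
        (1 - t₂) ^ 2 * t₂ * (1 - (t₁ + t₂ + t₁ * t₂)) := by
      rw [hA]; ring
    have : 0 ≤ (1 - t₂) ^ 2 * t₂ * (1 - (t₁ + t₂ + t₁ * t₂)) :=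
      mul_nonneg (by positivity) (by linarith)
    linarith
  have hApos : 0 ≤ A :=
    le_trans (mul_nonneg (mul_nonneg hR.le (by linarith)) (by positivity)) hAB
  have hlin : 0 ≤ A * u₂ - k * ((1 - t₁ * t₂) * (1 - t₂) * (1 + t₂ ^ 2)) * (1 - t₂) := by
    have h₁ := mul_le_mul_of_nonneg_left hlarge hApos
    have h₂ := mul_le_mul_of_nonneg_left hAB (mul_nonneg hk.le (by linarith : 0 ≤ 1 - t₂))
    linarith
  have hquad := mul_nonneg (sub_nonneg.2 hur) hlin
  have hround' := mul_le_mul_of_nonneg_left hround (sq_nonneg t₂)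
  have hu₁ : u₁ ^ 2 = (k * (1 - t₁ * t₂)) ^ 2 - u₂ ^ 2 := by linarith
  rw [hu₁] at hround'
  rw [hA] at hquad
  linarith

theorem leg_fits {k t₁ t₂ u₁ u₂ s : ℝ} (hk : 0 < k) (ht₁ : 0 < t₁) (ht₂ : 0 < t₂)
    (ht₁' : t₁ < 1) (ht₂' : t₂ < 1)
    (hle : t₁ + t₂ + t₁ * t₂ ≤ 1) (hu : u₁ ^ 2 + u₂ ^ 2 = (k * (1 - t₁ * t₂)) ^ 2)
    (hs : 0 ≤ s)
    (hround : u₂ ^ 2 * (1 - t₁) ^ 2 - u₁ ^ 2 * (1 - t₂) ^ 2 ≤ s ^ 2 * (1 - t₁) ^ 2)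
    {h w₁ w₂ H₁ H₂ : ℝ} (hh : h = 2 * k)
    (hw₁ : w₁ = k * (1 - t₁ ^ 2) / t₁) (hw₂ : w₂ = k * (1 - t₂ ^ 2) / t₂)
    (hH₁ : H₁ = k * (1 + t₁ ^ 2) / t₁) (hH₂ : H₂ = k * (1 + t₂ ^ 2) / t₂) :
    (u₂ * (1 + t₂) / t₂ - w₂) * (h * (w₁ + w₂)) ≤
      s * (h * (w₁ + w₂) + w₁ * H₂ - w₂ * H₁) := by
  have hmain := mul_le_mul_of_nonneg_left
    (rounding_suffices hk ht₁ ht₂ ht₁' ht₂' hle hu hs hround)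
    (by positivity : 0 ≤ 2 * k ^ 2 * (t₁ + t₂) * (1 + t₂) / (t₁ * t₂ ^ 2))
  have hlhs : (u₂ * (1 + t₂) / t₂ - w₂) * (h * (w₁ + w₂)) =
      2 * k ^ 2 * (t₁ + t₂) * (1 + t₂) / (t₁ * t₂ ^ 2) *
        ((u₂ - k * (1 - t₂)) * (1 - t₁ * t₂)) := by
    subst hh hw₁ hw₂
    field_simp
    ring
  have hrhs : s * (h * (w₁ + w₂) + w₁ * H₂ - w₂ * H₁) =
      2 * k ^ 2 * (t₁ + t₂) * (1 + t₂) / (t₁ * t₂ ^ 2) * (s * (1 - t₁) * t₂) := by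
    subst hh hw₁ hw₂ hH₁ hH₂
    field_simp
    ring
  rw [hlhs, hrhs]
  exact hmain

theorem rounding_of_conjugated {k t₁ t₂ a₁ a₂ b₂ : ℝ} (hk : 0 < k) (ht₁' : t₁ < 1)
    (ha₁ : 0 ≤ a₁) (ha₂ : 0 ≤ a₂) (hb₂ : 0 ≤ b₂)
    (hconj : a₂ - Real.pi * (k * (1 - t₂)) ^ 2 * a₁ / (Real.pi * (k * (1 - t₁)) ^ 2) ≤ b₂) :
    Real.sqrt (a₂ / Real.pi) ^ 2 * (1 - t₁) ^ 2 - Real.sqrt (a₁ / Real.pi) ^ 2 * (1 - t₂) ^ 2 ≤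
      Real.sqrt (b₂ / Real.pi) ^ 2 * (1 - t₁) ^ 2 := by
  have hπ := Real.pi_pos
  have ht : 0 < 1 - t₁ := by linarith
  rw [Real.sq_sqrt (by positivity), Real.sq_sqrt (by positivity), Real.sq_sqrt (by positivity)]
  have := mul_le_mul_of_nonneg_right hconj (by positivity : 0 ≤ (1 - t₁) ^ 2 / Real.pi)
  calc
    _ = (a₂ - Real.pi * (k * (1 - t₂)) ^ 2 * a₁ / (Real.pi * (k * (1 - t₁)) ^ 2)) *
        ((1 - t₁) ^ 2 / Real.pi) := by field_simp
    _ ≤ b₂ * ((1 - t₁) ^ 2 / Real.pi) := this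
    _ = _ := by ring

/-- Hats-in-hat packing: a non-acute triangle `T` (up to isometry: apex `(0,h)` over the
base from `(−w₁,0)` to `(w₂,0)`, non-acute at the apex since `h² ≤ w₁·w₂`) has incircle
area `a`, base angles `α = arctan(h/w₁)`, `β = arctan(h/w₂)`, and associated split key
`(f₁, f₂)` given by the incircle areas of the two right triangles cut off by the altitude
through the apex. For all `(a, 0, (f₁,f₂))`-conjugated tuples `(a₁,b₁)`, `(a₂,b₂)` with
`b₁ ≤ a₁`, `b₂ ≤ a₂`, a right `(a₁,b₁)`-hat with acute angle `α` and a right `(a₂,b₂)`-hat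
with acute angle `β` can be packed into `T`. -/
theorem hats_in_hat (h w₁ w₂ : ℝ) (hh : 0 < h) (hw₁ : 0 < w₁) (hw₂ : 0 < w₂)
    (hnonacute : h ^ 2 ≤ w₁ * w₂)
    (a f₁ f₂ α β : ℝ)
    (ha : a = Real.pi * (h * (w₁ + w₂) /
      (w₁ + w₂ + Real.sqrt (h ^ 2 + w₁ ^ 2) + Real.sqrt (h ^ 2 + w₂ ^ 2))) ^ 2)
    (hf₁ : f₁ = Real.pi * rho h w₁ ^ 2) (hf₂ : f₂ = Real.pi * rho h w₂ ^ 2)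
    (hα : α = Real.arctan (h / w₁)) (hβ : β = Real.arctan (h / w₂))
    (a₁ b₁ a₂ b₂ : ℝ) (ha₁ : 0 ≤ a₁) (hb₁ : 0 ≤ b₁) (ha₂ : 0 ≤ a₂) (hb₂ : 0 ≤ b₂)
    (hconj : Conjugated a 0 f₁ f₂ a₁ b₁ a₂ b₂)
    (hb₁a₁ : b₁ ≤ a₁) (hb₂a₂ : b₂ ≤ a₂) :
    ∃ g₁ g₂ : Plane ≃ᵢ Plane,
      g₁ '' rightHatAngle α a₁ b₁ ⊆
        convexHull ℝ ({pt 0 h, pt (-w₁) 0, pt w₂ 0} : Set Plane) ∧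
      g₂ '' rightHatAngle β a₂ b₂ ⊆
        convexHull ℝ ({pt 0 h, pt (-w₁) 0, pt w₂ 0} : Set Plane) ∧
      Disjoint (interior (g₁ '' rightHatAngle α a₁ b₁))
               (interior (g₂ '' rightHatAngle β a₂ b₂)) := by
  obtain ⟨t₁, ht₁, ht₁', hwt₁, hH₁, hF₁, hρ₁⟩ := exists_halfAngle hh hw₁
  obtain ⟨t₂, ht₂, ht₂', hwt₂, hH₂, hF₂, hρ₂⟩ := exists_halfAngle hh hw₂
  have hπ := Real.pi_pos
  obtain ⟨k, hk⟩ : ∃ k, k = h / 2 := ⟨_, rfl⟩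
  have hkpos : 0 < k := by rw [hk]; positivity
  have hhk : h = 2 * k := by rw [hk]; ring
  have hwk₁ : w₁ = k * (1 - t₁ ^ 2) / t₁ := by rw [hwt₁, hk]; field_simp
  have hwk₂ : w₂ = k * (1 - t₂ ^ 2) / t₂ := by rw [hwt₂, hk]; field_simp
  have hHk₁ : √(h ^ 2 + w₁ ^ 2) = k * (1 + t₁ ^ 2) / t₁ := by rw [hH₁, hk]; field_simp
  have hHk₂ : √(h ^ 2 + w₂ ^ 2) = k * (1 + t₂ ^ 2) / t₂ := by rw [hH₂, hk]; field_simp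
  have hle : t₁ + t₂ + t₁ * t₂ ≤ 1 := by
    have h4 : 4 * (t₁ * t₂) ≤ (1 - t₁ ^ 2) * (1 - t₂ ^ 2) := by
      have hw : w₁ * w₂ = k ^ 2 / (t₁ * t₂) * ((1 - t₁ ^ 2) * (1 - t₂ ^ 2)) := by
        rw [hwk₁, hwk₂]; field_simp
      have h2 : h ^ 2 = k ^ 2 / (t₁ * t₂) * (4 * (t₁ * t₂)) := by
        rw [hhk]; field_simp; norm_num
      rw [hw, h2] at hnonacute
      exact le_of_mul_le_mul_left hnonacute (by positivity)
    have : t₁ + t₂ ≤ 1 - t₁ * t₂ :=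
      (abs_le_of_sq_le_sq' (by linarith) (by nlinarith)).2
    linarith
  have har : a = Real.pi * (k * (1 - t₁ * t₂)) ^ 2 := by
    rw [ha, hHk₁, hHk₂]
    congr 2
    rw [div_eq_iff (by positivity), hwk₁, hwk₂, hhk]
    field_simp
    ring
  rw [← hk] at hF₁ hF₂
  obtain ⟨hsum, -, -, hc₁, hc₂⟩ := hconj
  rw [hf₁, hf₂, hF₁, hF₂] at hc₁ hc₂
  have hu : √(a₁ / Real.pi) ^ 2 + √(a₂ / Real.pi) ^ 2 = (k * (1 - t₁ * t₂)) ^ 2 := by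
    rw [Real.sq_sqrt (by positivity), Real.sq_sqrt (by positivity), ← add_div, hsum, har]
    field_simp
  have hr₁ := rounding_of_conjugated hkpos ht₂' ha₂ ha₁ hb₁ hc₁
  have hr₂ := rounding_of_conjugated hkpos ht₁' ha₁ ha₂ hb₂ hc₂
  have hfit₂ := leg_fits hkpos ht₁ ht₂ ht₁' ht₂' hle hu (Real.sqrt_nonneg _) hr₂ hhk hwk₁ hwk₂
    hHk₁ hHk₂
  have hfit₁ := leg_fits hkpos ht₂ ht₁ ht₂' ht₁' (by linarith) (by linarith)
    (Real.sqrt_nonneg _) hr₁ hhk hwk₂ hwk₁ hHk₂ hHk₁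
  have hlegs := legs_add_le hkpos ht₁ ht₂ hle hu
  rw [← hwk₁, ← hwk₂] at hlegs
  have hℓ₁ : √(a₁ / Real.pi) / (t₁ / (1 + t₁)) = √(a₁ / Real.pi) * (1 + t₁) / t₁ := by
    field_simp
  have hℓ₂ : √(a₂ / Real.pi) / (t₂ / (1 + t₂)) = √(a₂ / Real.pi) * (1 + t₂) / t₂ := by
    field_simp
  have hmem₁ (p : Plane) (hp : p ∈ rightHatAngle α a₁ b₁) :=
    placed_roundCorners_halfPlanes hh hw₂ hw₁ (by positivity : 0 < √(h ^ 2 + w₂ ^ 2))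
      (by positivity : 0 < √(h ^ 2 + w₁ ^ 2)) (Real.sq_sqrt (by positivity))
      (Real.sq_sqrt (by positivity)) (by positivity) (Real.sqrt_nonneg (b₁ / Real.pi)) hfit₁
      (p := p)
      (by rwa [rightHatAngle, rightTriangleAngle, hα, Real.tan_arctan, hρ₁, hℓ₁] at hp)
  have hmem₂ (p : Plane) (hp : p ∈ rightHatAngle β a₂ b₂) :=
    placed_roundCorners_halfPlanes hh hw₁ hw₂ (by positivity : 0 < √(h ^ 2 + w₁ ^ 2))
      (by positivity : 0 < √(h ^ 2 + w₂ ^ 2)) (Real.sq_sqrt (by positivity))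
      (Real.sq_sqrt (by positivity)) (by positivity) (Real.sqrt_nonneg (b₂ / Real.pi)) hfit₂
      (p := p)
      (by rwa [rightHatAngle, rightTriangleAngle, hβ, Real.tan_arctan, hρ₂, hℓ₂] at hp)
  refine ⟨horizontalReflection (√(a₁ / Real.pi) * (1 + t₁) / t₁ - w₁),
    horizontalShift (w₂ - √(a₂ / Real.pi) * (1 + t₂) / t₂), ?_, ?_, ?_⟩
  · rintro _ ⟨p, hp, rfl⟩
    obtain ⟨-, h₁, h₂, h₃⟩ := hmem₁ p hp
    rw [horizontalReflection_apply]
    apply mem_triangle_of_halfPlanes hh hw₁ hw₂ <;>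
      simp only [pt_apply_zero, pt_apply_one] <;> linarith
  · rintro _ ⟨p, hp, rfl⟩
    obtain ⟨-, h₁, h₂, h₃⟩ := hmem₂ p hp
    rw [horizontalShift_apply]
    apply mem_triangle_of_halfPlanes hh hw₁ hw₂ <;>
      simp only [pt_apply_zero, pt_apply_one] <;> linarith
  · apply disjoint_interior_of_separated (m := √(a₁ / Real.pi) * (1 + t₁) / t₁ - w₁)
    · rintro _ ⟨p, hp, rfl⟩
      have := (hmem₁ p hp).1
      simp only [horizontalReflection_apply, pt_apply_zero]
      linarith
    · rintro _ ⟨p, hp, rfl⟩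
      have := (hmem₂ p hp).1
      simp only [horizontalShift_apply, pt_apply_zero]
      linarith
end
end

section
/- Let h, w₁, w₂ be positive reals with w₁·w₂ ≥ h² (so that the triangle with apex at (0,h) and base vertices (−w₁,0) and (w₂,0) is non-acute at the apex). For positive p, q let ρ(p,q) = (p + q − √(p² + q²))/2 denote the inradius of a right triangle with legs p and q, and let r = h(w₁+w₂)/(w₁ + w₂ + √(h²+w₁²) + √(h²+w₂²)) denote the inradius of the whole triangle. Then ρ(h,w₁)² + ρ(h,w₂)² ≥ r². (Equivalently: in a non-acute triangle, the incircle areas f₁, f₂ of the two right triangles cut off by the altitude through the apex satisfy f₁ + f₂ ≥ a, where a is the incircle area of the triangle.) -/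
noncomputable section

/-- Half-angle parametrization of a right triangle with legs `h` and `w`. -/
theorem exists_half_angle_tangent {h w : ℝ} (hh : 0 < h) (hw : 0 < w) :
    ∃ x : ℝ, 0 < x ∧ x < 1 ∧ w = h * (1 - x ^ 2) / (2 * x) ∧
      Real.sqrt (h ^ 2 + w ^ 2) = h * (1 + x ^ 2) / (2 * x) := by
  set s := Real.sqrt (h ^ 2 + w ^ 2) with hs
  have hsq : s ^ 2 = h ^ 2 + w ^ 2 := Real.sq_sqrt (by positivity)
  have hs0 : 0 ≤ s := Real.sqrt_nonneg _
  have hws : w < s := by nlinarith [pow_pos hh 2]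
  have hsh : s < h + w := by nlinarith [mul_pos hh hw]
  have hd : s - w ≠ 0 := (sub_pos.2 hws).ne'
  refine ⟨(s - w) / h, div_pos (by linarith) hh, (div_lt_one hh).2 (by linarith), ?_, ?_⟩
  · field_simp
    linear_combination hsq
  · field_simp
    linear_combination hsq

/-- The inradius of a right triangle in terms of a half-angle tangent. -/
theorem rho_eq_of_half_angle_tangent {h w x : ℝ} (hx : x ≠ 0)
    (hw : w = h * (1 - x ^ 2) / (2 * x))
    (hs : Real.sqrt (h ^ 2 + w ^ 2) = h * (1 + x ^ 2) / (2 * x)) :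
    rho h w = h * (1 - x) / 2 := by
  rw [rho, hs, hw]
  field_simp
  ring

/-- In a non-acute triangle (apex `(0,h)` over base from `(−w₁,0)` to `(w₂,0)`, with
`w₁·w₂ ≥ h²`), the squared inradii of the two right triangles cut off by the altitude
through the apex sum to at least the squared inradius of the whole triangle
(equivalently `f₁ + f₂ ≥ a` for the incircle areas). -/
theorem split_key_incircles_cover (h w₁ w₂ : ℝ)
    (hh : 0 < h) (hw₁ : 0 < w₁) (hw₂ : 0 < w₂) (hna : h ^ 2 ≤ w₁ * w₂) :
    (h * (w₁ + w₂) /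
        (w₁ + w₂ + Real.sqrt (h ^ 2 + w₁ ^ 2) + Real.sqrt (h ^ 2 + w₂ ^ 2))) ^ 2 ≤
      rho h w₁ ^ 2 + rho h w₂ ^ 2 := by
  obtain ⟨x, hx0, hx1, hwx, hsx⟩ := exists_half_angle_tangent hh hw₁
  obtain ⟨y, hy0, hy1, hwy, hsy⟩ := exists_half_angle_tangent hh hw₂
  have hr : h * (w₁ + w₂) /
      (w₁ + w₂ + Real.sqrt (h ^ 2 + w₁ ^ 2) + Real.sqrt (h ^ 2 + w₂ ^ 2)) =
      h * (1 - x * y) / 2 := by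
    have hden : w₁ + w₂ + Real.sqrt (h ^ 2 + w₁ ^ 2) + Real.sqrt (h ^ 2 + w₂ ^ 2) =
        h * (x + y) / (x * y) := by
      rw [hsx, hsy, hwx, hwy]
      field_simp
      ring
    have hxy : x + y ≠ 0 := (add_pos hx0 hy0).ne'
    rw [hden, hwx, hwy]
    field_simp
    ring
  rw [hr, rho_eq_of_half_angle_tangent hx0.ne' hwx hsx,
    rho_eq_of_half_angle_tangent hy0.ne' hwy hsy]
  have hprod : w₁ * w₂ = h ^ 2 * ((1 - x ^ 2) * (1 - y ^ 2) / (4 * (x * y))) := by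
    rw [hwx, hwy]
    field_simp
    ring
  have hangle : 4 * (x * y) ≤ (1 - x ^ 2) * (1 - y ^ 2) := by
    rw [hprod] at hna
    rw [← one_le_div (by positivity)]
    exact (le_mul_iff_one_le_right (by positivity)).1 hna
  have hxy1 : x * y < 1 := by nlinarith
  have hsum : x + y ≤ 1 - x * y :=
    abs_le_of_sq_le_sq' (by linarith) (by linarith) |>.2
  have hkey : 0 ≤ (1 - x - y - x * y) * (1 - x - y + x * y) :=
    mul_nonneg (by linarith) (by nlinarith [mul_pos hx0 hy0])
  nlinarith [mul_nonneg (sq_nonneg h) hkey]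
end
end

section
/- For all reals a > 0 and a₁ with 0 ≤ a₁ ≤ a/2, the inequality √(a−a₁)·(2+√2) − √(a−2a₁)·√2 ≤ (1+√2)·√a holds. (Key inequality showing the larger rounded hat fits inside the square in the hats-in-square packing.) -/
/-- Key inequality for the hats-in-square packing: for `0 ≤ a₁ ≤ a/2`,
`√(a−a₁)·(2+√2) − √(a−2a₁)·√2 ≤ (1+√2)·√a`. -/
theorem hat_in_square_inequality (a a₁ : ℝ) (ha : 0 < a) (h0 : 0 ≤ a₁) (h1 : a₁ ≤ a / 2) :
    Real.sqrt (a - a₁) * (2 + Real.sqrt 2) - Real.sqrt (a - 2 * a₁) * Real.sqrt 2 ≤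
      (1 + Real.sqrt 2) * Real.sqrt a := by
  set r := Real.sqrt 2
  set s := Real.sqrt a
  set x := Real.sqrt (a - a₁)
  set y := Real.sqrt (a - 2 * a₁)
  have hr : r ^ 2 = 2 := Real.sq_sqrt (by norm_num)
  have hs : s ^ 2 = a := Real.sq_sqrt ha.le
  have hx : x ^ 2 = a - a₁ := Real.sq_sqrt (by linarith)
  have hy : y ^ 2 = a - 2 * a₁ := Real.sq_sqrt (by linarith)
  have hr0 : 0 ≤ r := Real.sqrt_nonneg _
  have hs0 : 0 ≤ s := Real.sqrt_nonneg _
  have hx0 : 0 ≤ x := Real.sqrt_nonneg _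
  have hy0 : 0 ≤ y := Real.sqrt_nonneg _
  have hxs : x ≤ s := Real.sqrt_le_sqrt (by linarith)
  have hsx : s ≤ r * x := by
    refine (abs_le_of_sq_le_sq' ?_ (by positivity)).2
    rw [mul_pow, hr, hs, hx]
    linarith
  have hfactor : (r + 4) * x ≤ (5 + 2 * r) * s :=
    mul_le_mul (by linarith) hxs hx0 (by positivity)
  have hchord : (2 + r) * x - (1 + r) * s ≤ y * r := by
    refine (abs_le_of_sq_le_sq' ?_ (by positivity)).2
    have hdiff : (y * r) ^ 2 - ((2 + r) * x - (1 + r) * s) ^ 2 =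
        (r * x - s) * ((5 + 2 * r) * s - (r + 4) * x) := by
      have hxy : y ^ 2 = 2 * x ^ 2 - s ^ 2 := by rw [hx, hy, hs]; ring
      rw [mul_pow, hxy]
      linear_combination (2 * x ^ 2 - 2 * s ^ 2) * hr
    have := mul_nonneg (sub_nonneg.2 hsx) (sub_nonneg.2 hfactor)
    linarith
  linarith
end

section
/- Let a, f, a′ be reals with 0 < f < a and f ≤ a′ ≤ a, and set b = a·(a′ − f)/(a − f). Then √a′ − (1 − √(f/a))·√b ≤ √f. (Key inequality showing that a rounded hat whose incircle area a′ exceeds its split-key share f still fits inside a non-acute triangular container with incircle area a.) -/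
/-- Key inequality for fitting a rounded hat into a non-acute triangular container:
for `0 < f < a`, `f ≤ a′ ≤ a` and `b = a·(a′−f)/(a−f)`,
`√a′ − (1 − √(f/a))·√b ≤ √f`. -/
theorem rounded_hat_fits (a f a' b : ℝ) (hf : 0 < f) (hfa : f < a)
    (hfa' : f ≤ a') (ha' : a' ≤ a) (hb : b = a * (a' - f) / (a - f)) :
    Real.sqrt a' - (1 - Real.sqrt (f / a)) * Real.sqrt b ≤ Real.sqrt f := by
  have ha : 0 < a := hf.trans hfa
  obtain ⟨p, hp, rfl⟩ : ∃ p : ℝ, 0 < p ∧ f = p ^ 2 :=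
    ⟨√f, Real.sqrt_pos.2 hf, (Real.sq_sqrt hf.le).symm⟩
  obtain ⟨s, hs, rfl⟩ : ∃ s : ℝ, 0 < s ∧ a = s ^ 2 :=
    ⟨√a, Real.sqrt_pos.2 ha, (Real.sq_sqrt ha.le).symm⟩
  obtain ⟨x, hx, rfl⟩ : ∃ x : ℝ, 0 ≤ x ∧ a' = x ^ 2 :=
    ⟨√a', Real.sqrt_nonneg _, (Real.sq_sqrt (hf.le.trans hfa')).symm⟩
  have hps : p < s := lt_of_pow_lt_pow_left₀ 2 hs.le hfa
  have hpx : p ≤ x := (sq_le_sq₀ hp.le hx).1 hfa'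
  have hxs : x ≤ s := (sq_le_sq₀ hx hs.le).1 ha'
  have hsp : 0 < s - p := sub_pos.2 hps
  have key : s * (x - p) / (s - p) ≤ √b := by
    apply Real.le_sqrt_of_sq_le
    rw [hb, div_pow, div_le_div_iff₀ (by positivity) (sub_pos.2 hfa)]
    have h : 0 ≤ s ^ 2 * (s - p) * (x - p) * (2 * p * (s - x)) :=
      mul_nonneg (mul_nonneg (by positivity) (sub_nonneg.2 hpx))
        (mul_nonneg (by positivity) (sub_nonneg.2 hxs))
    linear_combination h
  rw [Real.sqrt_div' _ (sq_nonneg s), Real.sqrt_sq hp.le, Real.sqrt_sq hs.le, Real.sqrt_sq hx]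
  have h : (1 - p / s) * (s * (x - p) / (s - p)) = x - p := by
    field_simp
  have hc : 0 ≤ 1 - p / s := sub_nonneg.2 ((div_le_one hs).2 hps.le)
  linarith [mul_le_mul_of_nonneg_left key hc]
end
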